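/- Let h, α, δ be real constants with 1/2 < h < 1, α > 0 and δ > 0, for x > 0 set η̃(x) = x^{-2h}·exp( (2α/(1-2h))·x^{1-2h} - (δ/(1-h))·x^{2-2h} ), let Z = ∫₀^∞ η̃(x) dx, and let μ be the probability measure on (0,∞) with density η = η̃/Z with respect to Lebesgue measure. If (aₙ) and (bₙ) are sequences of positive reals such that μ((0,aₙ)) = μ((bₙ,∞)) for every n and μ((bₙ,∞)) → 0 as n → ∞, then [aₙ^h·η(aₙ)] / [bₙ^h·η(bₙ)] → ∞ as n → ∞. -/

import Mathlib

open Real Set MeasureTheory Filter Topology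

/-- The (unnormalized) invariant density of the generalized CIR model. -/
noncomputable def etaT (h α δ x : ℝ) : ℝ :=
  x ^ (-(2*h)) * Real.exp ((2*α/(1-2*h)) * x ^ (1-2*h) - (δ/(1-h)) * x ^ (2-2*h))

/-- The normalizing constant of the invariant density. -/
noncomputable def Zcst (h α δ : ℝ) : ℝ := ∫ x in Set.Ioi (0:ℝ), etaT h α δ x

/-- The normalized invariant density `η = η̃ / Z`. -/
noncomputable def etaN (h α δ x : ℝ) : ℝ := etaT h α δ x / Zcst h α δ

/-- The exponential factor of `etaT`. -/
noncomputable def etaExp (h α δ x : ℝ) : ℝ :=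
  Real.exp ((2*α/(1-2*h)) * x ^ (1-2*h) - (δ/(1-h)) * x ^ (2-2*h))

lemma etaT_eq (h α δ x : ℝ) : etaT h α δ x = x ^ (-(2*h)) * etaExp h α δ x := rfl

lemma etaExp_pos (h α δ x : ℝ) : 0 < etaExp h α δ x := Real.exp_pos _

lemma etaT_pos (h α δ : ℝ) {x : ℝ} (hx : 0 < x) : 0 < etaT h α δ x :=
  mul_pos (Real.rpow_pos_of_pos hx _) (Real.exp_pos _)

lemma hasDerivAt_etaExp {h α δ x : ℝ} (hh1 : 1/2 < h) (hh2 : h < 1) (hx : 0 < x) :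
    HasDerivAt (etaExp h α δ) (2 * (α - δ * x) * etaT h α δ x) x := by
  have e1 := ((Real.hasDerivAt_rpow_const (x := x) (p := 1-2*h) (Or.inl hx.ne')).const_mul
    (2*α/(1-2*h))).sub ((Real.hasDerivAt_rpow_const (x := x) (p := 2-2*h)
      (Or.inl hx.ne')).const_mul (δ/(1-h)))
  have e2 := e1.exp
  have n1 : 1 - 2*h ≠ 0 := by linarith
  have n2 : 1 - h ≠ 0 := by linarith
  refine e2.congr_deriv ?_
  have r1 : x ^ (1 - 2*h - 1) = x ^ (-(2*h)) := by congr 1; ring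
  have r2 : x ^ (2 - 2*h - 1) = x * x ^ (-(2*h)) := by
    rw [← Real.rpow_one_add' hx.le (by linarith)]; congr 1; ring
  rw [r1, r2, etaT]
  simp only [Pi.sub_apply]
  field_simp

lemma tendsto_exp_rpow_nhdsGT_zero {h α : ℝ} (hh1 : 1/2 < h) (hα : 0 < α) :
    Tendsto (fun x : ℝ => Real.exp ((2*α/(1-2*h)) * x ^ (1-2*h))) (𝓝[>] 0) (𝓝 0) := by
  refine Real.tendsto_exp_atBot.comp ?_
  exact (tendsto_rpow_neg_nhdsGT_zero (by linarith)).const_mul_atTop_of_neg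
    (div_neg_of_pos_of_neg (by linarith) (by linarith))

lemma etaExp_le {h α δ x : ℝ} (hh2 : h < 1) (hδ : 0 < δ) (hx : 0 < x) :
    etaExp h α δ x ≤ Real.exp ((2*α/(1-2*h)) * x ^ (1-2*h)) := by
  have : 0 ≤ (δ/(1-h)) * x ^ (2-2*h) :=
    mul_nonneg (div_nonneg hδ.le (by linarith)) (Real.rpow_nonneg hx.le _)
  exact Real.exp_le_exp.2 (by linarith)

lemma etaExp_le' {h α δ x : ℝ} (hh1 : 1/2 < h) (hα : 0 < α) (hx : 0 < x) :
    etaExp h α δ x ≤ Real.exp (- ((δ/(1-h)) * x ^ (2-2*h))) := by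
  have : (2*α/(1-2*h)) * x ^ (1-2*h) ≤ 0 :=
    mul_nonpos_of_nonpos_of_nonneg
      (div_nonpos_of_nonneg_of_nonpos (by linarith) (by linarith)) (Real.rpow_nonneg hx.le _)
  exact Real.exp_le_exp.2 (by linarith)

lemma tendsto_etaExp_nhdsGT_zero {h α δ : ℝ} (hh1 : 1/2 < h) (hh2 : h < 1) (hα : 0 < α)
    (hδ : 0 < δ) : Tendsto (etaExp h α δ) (𝓝[>] 0) (𝓝 0) := by
  refine squeeze_zero' (Eventually.of_forall fun x => (etaExp_pos _ _ _ x).le) ?_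
    (tendsto_exp_rpow_nhdsGT_zero hh1 hα)
  filter_upwards [self_mem_nhdsWithin] with x hx using etaExp_le hh2 hδ hx

lemma tendsto_etaExp_atTop {h α δ : ℝ} (hh1 : 1/2 < h) (hh2 : h < 1) (hα : 0 < α)
    (hδ : 0 < δ) : Tendsto (etaExp h α δ) atTop (𝓝 0) := by
  have hlim : Tendsto (fun x : ℝ => Real.exp (- ((δ/(1-h)) * x ^ (2-2*h)))) atTop (𝓝 0) :=
    Real.tendsto_exp_neg_atTop_nhds_zero.comp
      ((tendsto_rpow_atTop (by linarith)).const_mul_atTop (div_pos hδ (by linarith)))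
  refine squeeze_zero' (Eventually.of_forall fun x => (etaExp_pos _ _ _ x).le) ?_ hlim
  filter_upwards [eventually_gt_atTop 0] with x hx using etaExp_le' hh1 hα hx

lemma continuousOn_etaT (h α δ : ℝ) : ContinuousOn (etaT h α δ) (Ioi 0) := by
  have hp : ∀ p : ℝ, ContinuousOn (fun x : ℝ => x ^ p) (Ioi 0) := fun p x hx =>
    (Real.continuousAt_rpow_const x p (Or.inl (ne_of_gt hx))).continuousWithinAt
  exact (hp _).mul (Real.continuous_exp.comp_continuousOn
    (((hp _).const_smul (2*α/(1-2*h))).sub ((hp _).const_smul (δ/(1-h)))))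

lemma integrableOn_etaT {h α δ : ℝ} (hh1 : 1/2 < h) (hh2 : h < 1) (hα : 0 < α) (hδ : 0 < δ) :
    IntegrableOn (etaT h α δ) (Ioi 0) := by
  set f : ℝ → ℝ := fun x => Real.exp ((2*α/(1-2*h)) * x ^ (1-2*h)) with hf
  have hder : ∀ x ∈ Ioi (0:ℝ), HasDerivAt (Function.update f 0 0)
      (2 * α * (x ^ (-(2*h)) * f x)) x := by
    intro x hx
    have hx : 0 < x := hx
    have e1 := ((Real.hasDerivAt_rpow_const (x := x) (p := 1-2*h) (Or.inl hx.ne')).const_mul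
      (2*α/(1-2*h))).exp
    have r1 : x ^ (1 - 2*h - 1) = x ^ (-(2*h)) := by congr 1; ring
    have n1 : 1 - 2*h ≠ 0 := by linarith
    rw [r1] at e1
    refine (e1.congr_deriv ?_).congr_of_eventuallyEq ?_
    · simp only [hf]
      field_simp
    · filter_upwards [Ioi_mem_nhds hx] with y hy
      rw [Function.update_of_ne (ne_of_gt hy)]
  have hcont : ContinuousWithinAt (Function.update f 0 0) (Ici 0) 0 := by
    rw [continuousWithinAt_update_same]
    rw [Ici_sdiff_left]
    exact tendsto_exp_rpow_nhdsGT_zero hh1 hα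
  have hlim : Tendsto (Function.update f 0 0) atTop (𝓝 1) := by
    have h1 : Tendsto f atTop (𝓝 1) := by
      have := (tendsto_rpow_neg_atTop (y := 2*h-1) (by linarith)).const_mul (2*α/(1-2*h))
      rw [mul_zero] at this
      have := (Real.continuous_exp.tendsto 0).comp this
      rw [Real.exp_zero] at this
      refine this.congr fun x => ?_
      simp [hf]
    refine h1.congr' ?_
    filter_upwards [eventually_gt_atTop 0] with x hx
    rw [Function.update_of_ne (ne_of_gt hx)]
  have hintegrable := integrableOn_Ioi_deriv_of_nonneg hcont hder (fun x hx => by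
    have : 0 < x ^ (-(2*h)) := Real.rpow_pos_of_pos hx _
    have : 0 < f x := Real.exp_pos _
    positivity) hlim
  refine (hintegrable.const_mul (2*α)⁻¹).mono'
    ((continuousOn_etaT h α δ).aestronglyMeasurable measurableSet_Ioi) ?_
  refine (ae_restrict_mem measurableSet_Ioi).mono fun x hx => ?_
  have hx : 0 < x := hx
  rw [Real.norm_of_nonneg (etaT_pos h α δ hx).le, etaT_eq, inv_mul_cancel_left₀ (by positivity)]
  exact mul_le_mul_of_nonneg_left (etaExp_le hh2 hδ hx) (Real.rpow_nonneg hx.le _)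

lemma etaExp_eq_integral {h α δ a : ℝ} (hh1 : 1/2 < h) (hh2 : h < 1) (hα : 0 < α) (hδ : 0 < δ)
    (ha : 0 < a) : IntegrableOn (fun x => 2 * (α - δ * x) * etaT h α δ x) (Ioo 0 a) ∧
      ∫ x in Ioo 0 a, 2 * (α - δ * x) * etaT h α δ x = etaExp h α δ a := by
  have hi : IntegrableOn (etaT h α δ) (Ioc 0 a) :=
    (integrableOn_etaT hh1 hh2 hα hδ).mono_set Ioc_subset_Ioi_self
  have hintegrable : IntegrableOn (fun x => 2 * (α - δ * x) * etaT h α δ x) (Ioc 0 a) := by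
    refine Integrable.bdd_mul (c := 2 * (α + δ * a)) hi
      (Continuous.aestronglyMeasurable (by fun_prop)) ?_
    refine (ae_restrict_mem measurableSet_Ioc).mono fun x hx => ?_
    have h1 : 0 ≤ δ * x := mul_nonneg hδ.le hx.1.le
    have h2 : δ * x ≤ δ * a := mul_le_mul_of_nonneg_left hx.2 hδ.le
    rw [Real.norm_eq_abs, abs_le]
    constructor <;> linarith
  refine ⟨hintegrable.mono_set Ioo_subset_Ioc_self, ?_⟩
  have := intervalIntegral.integral_eq_sub_of_hasDerivAt_of_tendsto ha
    (fun x hx => hasDerivAt_etaExp (α := α) (δ := δ) hh1 hh2 hx.1)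
    ((intervalIntegrable_iff_integrableOn_Ioc_of_le ha.le).2 hintegrable)
    (tendsto_etaExp_nhdsGT_zero hh1 hh2 hα hδ)
    ((hasDerivAt_etaExp (α := α) (δ := δ) hh1 hh2 ha).continuousAt.tendsto.mono_left
      nhdsWithin_le_nhds)
  rw [← integral_Ioc_eq_integral_Ioo, ← intervalIntegral.integral_of_le ha.le, this, sub_zero]

lemma etaExp_le_integral_Ioo {h α δ a : ℝ} (hh1 : 1/2 < h) (hh2 : h < 1) (hα : 0 < α)
    (hδ : 0 < δ) (ha : 0 < a) :
    etaExp h α δ a ≤ 2 * α * ∫ x in Ioo 0 a, etaT h α δ x := by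
  obtain ⟨hintegrable, heq⟩ := etaExp_eq_integral hh1 hh2 hα hδ ha
  rw [← heq, ← integral_const_mul]
  refine setIntegral_mono_on hintegrable (((integrableOn_etaT hh1 hh2 hα hδ).mono_set
    Ioo_subset_Ioi_self).const_mul _) measurableSet_Ioo fun x hx => ?_
  refine mul_le_mul_of_nonneg_right ?_ (etaT_pos h α δ hx.1).le
  nlinarith [mul_pos hδ hx.1]

lemma integral_Ioo_le_etaExp {h α δ a : ℝ} (hh1 : 1/2 < h) (hh2 : h < 1) (hα : 0 < α)
    (hδ : 0 < δ) (ha : 0 < a) (ha' : 2 * (δ * a) ≤ α) :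
    α * ∫ x in Ioo 0 a, etaT h α δ x ≤ etaExp h α δ a := by
  obtain ⟨hintegrable, heq⟩ := etaExp_eq_integral hh1 hh2 hα hδ ha
  rw [← heq, ← integral_const_mul]
  refine setIntegral_mono_on (((integrableOn_etaT hh1 hh2 hα hδ).mono_set
    Ioo_subset_Ioi_self).const_mul _) hintegrable measurableSet_Ioo fun x hx => ?_
  refine mul_le_mul_of_nonneg_right ?_ (etaT_pos h α δ hx.1).le
  nlinarith [mul_le_mul_of_nonneg_left hx.2.le hδ.le]

lemma integral_Ioi_le_etaExp {h α δ b : ℝ} (hh1 : 1/2 < h) (hh2 : h < 1) (hα : 0 < α)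
    (hδ : 0 < δ) (hb : 0 < b) (hb' : α + 1 ≤ δ * b) :
    ∫ x in Ioi b, etaT h α δ x ≤ etaExp h α δ b := by
  have hpos : ∀ x ∈ Ioi b, 1 ≤ 2 * (δ * x - α) := fun x hx => by
    nlinarith [mul_le_mul_of_nonneg_left (le_of_lt hx) hδ.le]
  have hd : ∀ x ∈ Ici b, HasDerivAt (fun x => - etaExp h α δ x)
      (2 * (δ * x - α) * etaT h α δ x) x := fun x hx =>
    (hasDerivAt_etaExp (α := α) (δ := δ) hh1 hh2 (hb.trans_le hx)).neg.congr_deriv (by ring)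
  have hn : ∀ x ∈ Ioi b, 0 ≤ 2 * (δ * x - α) * etaT h α δ x := fun x hx =>
    mul_nonneg (zero_le_one.trans (hpos x hx)) (etaT_pos h α δ (hb.trans hx)).le
  have hl : Tendsto (fun x => - etaExp h α δ x) atTop (𝓝 0) := by
    simpa using (tendsto_etaExp_atTop hh1 hh2 hα hδ).neg
  have hintegrable := integrableOn_Ioi_deriv_of_nonneg' hd hn hl
  have heq := integral_Ioi_of_hasDerivAt_of_nonneg' hd hn hl
  rw [zero_sub, neg_neg] at heq
  rw [← heq]
  refine setIntegral_mono_on ((integrableOn_etaT hh1 hh2 hα hδ).mono_set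
    (Ioi_subset_Ioi hb.le)) hintegrable measurableSet_Ioi fun x hx => ?_
  exact le_mul_of_one_le_left (etaT_pos h α δ (hb.trans hx)).le (hpos x hx)

lemma etaExp_le_integral_Ioi {h α δ b : ℝ} (hh1 : 1/2 < h) (hh2 : h < 1) (hα : 0 < α)
    (hδ : 0 < δ) (hb : 1 ≤ b) (hb' : α ≤ δ * b) :
    etaExp h α δ b ≤ (2 * δ + 1) * b * ∫ x in Ioi b, etaT h α δ x := by
  have hb0 : 0 < b := by linarith
  have hd : ∀ x ∈ Ici b, HasDerivAt (fun x => - (etaExp h α δ x / x))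
      (2 * (δ - α / x) * etaT h α δ x + etaExp h α δ x / x ^ 2) x := fun x hx => by
    have hx0 : 0 < x := hb0.trans_le hx
    refine ((hasDerivAt_etaExp (α := α) (δ := δ) hh1 hh2 hx0).div (hasDerivAt_id x)
      hx0.ne').neg.congr_deriv ?_
    simp only [id]
    field_simp
    ring
  have hn : ∀ x ∈ Ioi b, 0 ≤ 2 * (δ - α / x) * etaT h α δ x + etaExp h α δ x / x ^ 2 :=
    fun x hx => by
    have hx0 : 0 < x := hb0.trans hx
    have h1 : α / x ≤ δ := by
      rw [div_le_iff₀ hx0]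
      exact hb'.trans (mul_le_mul_of_nonneg_left (le_of_lt hx) hδ.le)
    have h2 := etaT_pos h α δ hx0
    have h3 := etaExp_pos h α δ x
    have : 0 ≤ δ - α / x := by linarith
    positivity
  have hl : Tendsto (fun x => - (etaExp h α δ x / x)) atTop (𝓝 0) := by
    have := ((tendsto_etaExp_atTop hh1 hh2 hα hδ).mul tendsto_inv_atTop_zero).neg
    simpa [div_eq_mul_inv] using this
  have hintegrable := integrableOn_Ioi_deriv_of_nonneg' hd hn hl
  have heq := integral_Ioi_of_hasDerivAt_of_nonneg' hd hn hl
  rw [zero_sub, neg_neg] at heq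
  have key : etaExp h α δ b / b ≤ (2 * δ + 1) * ∫ x in Ioi b, etaT h α δ x := by
    rw [← heq, ← integral_const_mul]
    refine setIntegral_mono_on hintegrable (((integrableOn_etaT hh1 hh2 hα hδ).mono_set
      (Ioi_subset_Ioi hb0.le)).const_mul _) measurableSet_Ioi fun x hx => ?_
    have hx0 : 0 < x := hb0.trans hx
    have h2 := etaT_pos h α δ hx0
    have h3 : etaExp h α δ x / x ^ 2 ≤ etaT h α δ x := by
      rw [etaT_eq, div_eq_mul_inv, mul_comm]
      refine mul_le_mul_of_nonneg_right ?_ (etaExp_pos h α δ x).le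
      rw [← Real.rpow_natCast, ← Real.rpow_neg hx0.le]
      exact Real.rpow_le_rpow_of_exponent_le (hb.trans (le_of_lt hx)) (by push_cast; linarith)
    have h4 : 0 < α / x := by positivity
    nlinarith [mul_pos h4 h2]
  rw [div_le_iff₀ hb0] at key
  linarith

lemma setIntegral_etaT_pos {h α δ : ℝ} (hh1 : 1/2 < h) (hh2 : h < 1) (hα : 0 < α) (hδ : 0 < δ)
    {s : Set ℝ} (hs : MeasurableSet s) (hsub : s ⊆ Ioi 0) (hvol : 0 < volume s) :
    0 < ∫ x in s, etaT h α δ x := by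
  rw [setIntegral_pos_iff_support_of_nonneg_ae
    ((ae_restrict_mem hs).mono fun x hx => (etaT_pos h α δ (hsub hx)).le)
    ((integrableOn_etaT hh1 hh2 hα hδ).mono_set hsub)]
  have hsupp : s ⊆ Function.support (etaT h α δ) := fun x hx => (etaT_pos h α δ (hsub hx)).ne'
  rwa [inter_eq_right.2 hsupp]

lemma setIntegral_etaT_mono {h α δ : ℝ} (hh1 : 1/2 < h) (hh2 : h < 1) (hα : 0 < α) (hδ : 0 < δ)
    {s t : Set ℝ} (ht : MeasurableSet t) (hst : s ⊆ t) (hsub : t ⊆ Ioi 0) :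
    ∫ x in s, etaT h α δ x ≤ ∫ x in t, etaT h α δ x :=
  setIntegral_mono_set ((integrableOn_etaT hh1 hh2 hα hδ).mono_set hsub)
    ((ae_restrict_mem ht).mono fun _ hx => (etaT_pos h α δ (hsub hx)).le) hst.eventuallyLE

lemma Zcst_pos {h α δ : ℝ} (hh1 : 1/2 < h) (hh2 : h < 1) (hα : 0 < α) (hδ : 0 < δ) :
    0 < Zcst h α δ :=
  setIntegral_etaT_pos hh1 hh2 hα hδ measurableSet_Ioi Subset.rfl (by simp)

lemma tendsto_atTop_of_integral_Ioi_etaT {h α δ : ℝ} (hh1 : 1/2 < h) (hh2 : h < 1) (hα : 0 < α)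
    (hδ : 0 < δ) {b : ℕ → ℝ} (hb : ∀ n, 0 < b n)
    (h0 : Tendsto (fun n => ∫ x in Ioi (b n), etaT h α δ x) atTop (𝓝 0)) :
    Tendsto b atTop atTop := by
  refine tendsto_atTop.2 fun c => ?_
  have hpos := setIntegral_etaT_pos hh1 hh2 hα hδ (measurableSet_Ioi (a := max c 0))
    (Ioi_subset_Ioi (le_max_right c 0)) (by simp)
  filter_upwards [h0.eventually_lt_const hpos] with n hn
  by_contra! hcn
  exact hn.not_ge (setIntegral_etaT_mono hh1 hh2 hα hδ measurableSet_Ioi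
    (Ioi_subset_Ioi (hcn.le.trans (le_max_left c 0))) (Ioi_subset_Ioi (hb n).le))

lemma tendsto_zero_of_integral_Ioo_etaT {h α δ : ℝ} (hh1 : 1/2 < h) (hh2 : h < 1) (hα : 0 < α)
    (hδ : 0 < δ) {a : ℕ → ℝ} (ha : ∀ n, 0 < a n)
    (h0 : Tendsto (fun n => ∫ x in Ioo 0 (a n), etaT h α δ x) atTop (𝓝 0)) :
    Tendsto a atTop (𝓝[>] 0) := by
  refine tendsto_nhdsWithin_iff.2 ⟨?_, Eventually.of_forall ha⟩
  refine tendsto_order.2 ⟨fun c hc => Eventually.of_forall fun n => hc.trans (ha n),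
    fun c hc => ?_⟩
  have hpos := setIntegral_etaT_pos hh1 hh2 hα hδ (measurableSet_Ioo (a := 0) (b := c))
    Ioo_subset_Ioi_self (by simpa using hc)
  filter_upwards [h0.eventually_lt_const hpos] with n hn
  by_contra! hcn
  exact hn.not_ge (setIntegral_etaT_mono hh1 hh2 hα hδ measurableSet_Ioo
    (Ioo_subset_Ioo_right hcn) Ioo_subset_Ioi_self)

lemma rpow_le_of_etaExp_le {h α δ a b : ℝ} (hh1 : 1/2 < h) (hh2 : h < 1) (hα : 0 < α)
    (hδ : 0 < δ) (ha : 0 < a) (ha1 : a ≤ 1) (hb : 0 < b)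
    (hb' : 2 * (δ / (1 - h) + Real.log (2 * α)) ≤ δ / (1 - h) * b ^ (2 - 2*h))
    (hab : etaExp h α δ a ≤ 2 * α * etaExp h α δ b) :
    δ * (2*h - 1) / (4 * α * (1 - h)) * b ^ (2 - 2*h) ≤ a ^ (1 - 2*h) := by
  have h1 : (2*α/(1-2*h)) * a ^ (1-2*h) - (δ/(1-h)) * a ^ (2-2*h) ≤
      Real.log (2*α) - (δ/(1-h)) * b ^ (2-2*h) := by
    rw [← Real.exp_le_exp, sub_eq_add_neg (Real.log _), Real.exp_add, Real.exp_log (by positivity)]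
    exact hab.trans (mul_le_mul_of_nonneg_left (etaExp_le' hh1 hα hb) (by positivity))
  have hD : 0 < δ / (1 - h) := div_pos hδ (by linarith)
  have h2 : δ / (1 - h) * a ^ (2-2*h) ≤ δ / (1-h) :=
    mul_le_of_le_one_right hD.le (Real.rpow_le_one ha.le ha1 (by linarith))
  have h3 : δ / (1-h) * b ^ (2-2*h) / 2 ≤ 2 * α / (2*h-1) * a ^ (1-2*h) := by
    have : 2*α/(1-2*h) = - (2*α/(2*h-1)) := by
      rw [← div_neg]; congr 1; ring
    rw [this] at h1
    linarith
  have hp : 0 < 2*h - 1 := by linarith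
  have hq : 0 < 1 - h := by linarith
  have h4 := mul_le_mul_of_nonneg_left h3 (show 0 ≤ (2*h-1)/(2*α) by positivity)
  calc _ = (2*h-1)/(2*α) * (δ / (1-h) * b ^ (2-2*h) / 2) := by field_simp; ring
    _ ≤ _ := h4
    _ = _ := by field_simp

lemma rpow_neg_half_le {h a b c : ℝ} (ha : 0 < a) (hb : 0 < b) (hc : 0 < c)
    (hab : c * b ^ (2 - 2*h) ≤ a ^ (1 - 2*h)) :
    c ^ (1/2 : ℝ) * a ^ (-(1/2) : ℝ) ≤ a ^ (-h) * b ^ (h - 1) := by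
  have h1 := Real.rpow_le_rpow (by positivity) hab (show (0:ℝ) ≤ 1/2 by norm_num)
  rw [Real.mul_rpow hc.le (by positivity), ← Real.rpow_mul hb.le, ← Real.rpow_mul ha.le] at h1
  have h2 := mul_le_mul_of_nonneg_right h1
    (show 0 ≤ a ^ (-(1/2) : ℝ) * b ^ (h - 1) by positivity)
  calc _ = c ^ (1/2 : ℝ) * b ^ ((2-2*h)*(1/2)) * (a ^ (-(1/2) : ℝ) * b ^ (h - 1)) := by
        have : b ^ ((2-2*h)*(1/2)) * b ^ (h - 1) = 1 := by
          rw [← Real.rpow_add hb, show (2-2*h)*(1/2) + (h-1) = 0 by ring, Real.rpow_zero]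
        linear_combination (- c ^ (1/2 : ℝ) * a ^ (-(1/2) : ℝ)) * this
    _ ≤ _ := h2
    _ = _ := by
        rw [← mul_assoc, ← Real.rpow_add ha]; congr 2; ring

lemma rpow_mul_etaT {h α δ x : ℝ} (hx : 0 < x) :
    x ^ h * etaT h α δ x = x ^ (-h) * etaExp h α δ x := by
  rw [etaT_eq, ← mul_assoc, ← Real.rpow_add hx]; congr 2; ring

theorem stmt_9 (h α δ : ℝ) (hh1 : 1/2 < h) (hh2 : h < 1) (hα : 0 < α) (hδ : 0 < δ)
    (a b : ℕ → ℝ) (ha : ∀ n, 0 < a n) (hb : ∀ n, 0 < b n)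
    (heq : ∀ n, (∫ y in Set.Ioo 0 (a n), etaN h α δ y) = ∫ y in Set.Ioi (b n), etaN h α δ y)
    (h0 : Tendsto (fun n => ∫ y in Set.Ioi (b n), etaN h α δ y) atTop (𝓝 0)) :
    Tendsto (fun n => (a n) ^ h * etaN h α δ (a n) / ((b n) ^ h * etaN h α δ (b n)))
      atTop atTop := by
  have hZ := Zcst_pos hh1 hh2 hα hδ
  have heq' : ∀ n, ∫ y in Ioo 0 (a n), etaT h α δ y = ∫ y in Ioi (b n), etaT h α δ y := by
    intro n
    have := heq n
    simp only [etaN, integral_div] at this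
    exact (div_left_inj' hZ.ne').1 this
  have h0' : Tendsto (fun n => ∫ y in Ioi (b n), etaT h α δ y) atTop (𝓝 0) := by
    have := h0.mul_const (Zcst h α δ)
    simpa only [etaN, integral_div, div_mul_cancel₀ _ hZ.ne', zero_mul] using this
  have hbt := tendsto_atTop_of_integral_Ioi_etaT hh1 hh2 hα hδ hb h0'
  have hat := tendsto_zero_of_integral_Ioo_etaT hh1 hh2 hα hδ ha
    (h0'.congr fun n => (heq' n).symm)
  have hp : 0 < 2*h - 1 := by linarith
  have hq : 0 < 1 - h := by linarith
  set c := δ * (2*h - 1) / (4 * α * (1 - h))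
  have hc : 0 < c := by positivity
  have hlim := ((tendsto_rpow_neg_nhdsGT_zero (y := -(1/2)) (by norm_num)).comp
    hat).const_mul_atTop (show 0 < α / (2 * δ + 1) * c ^ (1/2 : ℝ) by positivity)
  refine tendsto_atTop_mono' _ ?_ hlim
  have hbq := (((tendsto_rpow_atTop (y := 2 - 2*h) (by linarith)).const_mul_atTop
    (show 0 < δ / (1 - h) by positivity)).comp hbt).eventually_ge_atTop
      (2 * (δ / (1 - h) + Real.log (2 * α)))
  have hat0 := (tendsto_nhdsWithin_iff.1 hat).1
  filter_upwards [hbq, hat0.eventually_le_const zero_lt_one,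
    hat0.eventually_le_const (show 0 < α / (2 * δ) by positivity),
    hbt.eventually_ge_atTop 1, hbt.eventually_ge_atTop ((α + 1) / δ)] with n h1 h2 h3 h4 h5
  have h3' : 2 * (δ * a n) ≤ α := by
    rw [le_div_iff₀ (by positivity)] at h3; linarith
  have h5' : α + 1 ≤ δ * b n := by
    rw [div_le_iff₀ hδ] at h5; linarith
  have A1 := etaExp_le_integral_Ioo hh1 hh2 hα hδ (ha n)
  have A2 := integral_Ioo_le_etaExp hh1 hh2 hα hδ (ha n) h3'
  have B1 := integral_Ioi_le_etaExp hh1 hh2 hα hδ (hb n) h5'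
  have B2 := etaExp_le_integral_Ioi hh1 hh2 hα hδ h4 (by linarith)
  rw [heq' n] at A1 A2
  have hE := etaExp_pos h α δ (b n)
  have key := rpow_neg_half_le (ha n) (hb n) hc (rpow_le_of_etaExp_le hh1 hh2 hα hδ (ha n) h2
    (hb n) h1 (A1.trans (mul_le_mul_of_nonneg_left B1 (by positivity))))
  have hratio : (a n) ^ h * etaN h α δ (a n) / ((b n) ^ h * etaN h α δ (b n)) =
      (a n) ^ (-h) * etaExp h α δ (a n) / ((b n) ^ (-h) * etaExp h α δ (b n)) := by
    rw [← rpow_mul_etaT (ha n), ← rpow_mul_etaT (hb n)]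
    simp only [etaN, ← mul_div_assoc]
    exact div_div_div_cancel_right₀ hZ.ne' _ _
  have hbpos : 0 < (b n) ^ (-h) := Real.rpow_pos_of_pos (hb n) _
  have hapos : 0 < (a n) ^ (-h) := Real.rpow_pos_of_pos (ha n) _
  have hb1 : (b n) ^ (-h) * b n * (b n) ^ (h - 1) = 1 := by
    rw [← Real.rpow_add_one (hb n).ne', ← Real.rpow_add (hb n),
      show -h + 1 + (h - 1) = 0 by ring, Real.rpow_zero]
  have hD : 0 < 2 * δ + 1 := by positivity
  have hEE : α * etaExp h α δ (b n) ≤ (2 * δ + 1) * b n * etaExp h α δ (a n) := by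
    calc _ ≤ α * ((2 * δ + 1) * b n * ∫ x in Ioi (b n), etaT h α δ x) :=
          mul_le_mul_of_nonneg_left B2 hα.le
      _ = (2 * δ + 1) * b n * (α * ∫ x in Ioi (b n), etaT h α δ x) := by ring
      _ ≤ _ := mul_le_mul_of_nonneg_left A2 (mul_pos hD (hb n)).le
  rw [hratio, le_div_iff₀ (by positivity)]
  calc α / (2 * δ + 1) * c ^ (1/2 : ℝ) * (a n) ^ (-(1/2) : ℝ) *
        ((b n) ^ (-h) * etaExp h α δ (b n))
      = c ^ (1/2 : ℝ) * (a n) ^ (-(1/2) : ℝ) *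
        ((b n) ^ (-h) / (2 * δ + 1) * (α * etaExp h α δ (b n))) := by ring
    _ ≤ (a n) ^ (-h) * (b n) ^ (h - 1) *
        ((b n) ^ (-h) / (2 * δ + 1) * ((2 * δ + 1) * b n * etaExp h α δ (a n))) := by
        gcongr
    _ = (a n) ^ (-h) * etaExp h α δ (a n) * ((b n) ^ (-h) * b n * (b n) ^ (h - 1)) := by
        field_simp
    _ = _ := by rw [hb1, mul_one]
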